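/- Let Λ be a Nakayama algebra, and let G and G' be maximal backwards Hom-orthogonal sequences of bricks over Λ such that every entry of G' is isomorphic to some entry of G. Then G can be transformed into a sequence equal to G' up to isomorphism of corresponding entries by a finite sequence of moves, where every intermediate sequence is again a maximal backwards Hom-orthogonal sequence of bricks, and each move is either (a) a swap of two adjacent entries, or (b) an increasing elementary polygonal deformation, namely the replacement of a consecutive segment of the form C, D_1, …, D_s, C' (with s ≥ 1) by the two-entry segment C', C. -/

import Mathlib

/-- A bundled finite-dimensional module over the finite-dimensional `K`-algebra `Λ`
(finite-dimensionality over the base field is equivalent to being finitely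
generated over `Λ`). -/
structure FDModule (Λ : Type) [Ring Λ] : Type 1 where
  carrier : Type
  [isAddCommGroup : AddCommGroup carrier]
  [isModule : Module Λ carrier]
  [isFinite : Module.Finite Λ carrier]

attribute [instance] FDModule.isAddCommGroup FDModule.isModule FDModule.isFinite

/-- `M` is a brick: `M` is non-zero and every non-zero endomorphism of `M` is an
isomorphism. -/
def IsBrick {Λ : Type} [Ring Λ] (M : FDModule Λ) : Prop :=
  Nontrivial M.carrier ∧ ∀ f : M.carrier →ₗ[Λ] M.carrier, f = 0 ∨ Function.Bijective f

/-- `Hom_Λ(M, N) = 0`. -/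
def NoHom {Λ : Type} [Ring Λ] (M N : FDModule Λ) : Prop :=
  ∀ f : M.carrier →ₗ[Λ] N.carrier, f = 0

/-- A list of modules is backwards Hom-orthogonal: homomorphisms from later
entries to earlier entries vanish. -/
def ListBHO {Λ : Type} [Ring Λ] (l : List (FDModule Λ)) : Prop :=
  l.Pairwise fun M N => ∀ f : N.carrier →ₗ[Λ] M.carrier, f = 0

/-- A maximal backwards Hom-orthogonal list of bricks: every entry is a brick, the
list is backwards Hom-orthogonal, and no brick can be inserted at any position
while keeping backwards Hom-orthogonality. -/
def IsMaxBHOList {Λ : Type} [Ring Λ] (l : List (FDModule Λ)) : Prop :=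
  (∀ M ∈ l, IsBrick M) ∧ ListBHO l ∧
    ∀ C : FDModule Λ, IsBrick C →
      ∀ l₁ l₂ : List (FDModule Λ), l = l₁ ++ l₂ → ¬ ListBHO (l₁ ++ C :: l₂)

/-- A module is uniserial if its submodules are totally ordered by inclusion. -/
def IsUniserialModule (Λ : Type) [Ring Λ] (M : Type) [AddCommGroup M] [Module Λ M] : Prop :=
  ∀ N₁ N₂ : Submodule Λ M, N₁ ≤ N₂ ∨ N₂ ≤ N₁

/-- A module is indecomposable if it is non-zero and is not the direct sum of two
non-zero submodules. -/
def IsIndecomposableModule (Λ : Type) [Ring Λ] (M : Type) [AddCommGroup M]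
    [Module Λ M] : Prop :=
  Nontrivial M ∧ ∀ N₁ N₂ : Submodule Λ M, IsCompl N₁ N₂ → N₁ = ⊥ ∨ N₂ = ⊥

/-- `Λ` is a Nakayama algebra: every finite-dimensional indecomposable `Λ`-module
is uniserial. -/
def IsNakayama (Λ : Type) [Ring Λ] : Prop :=
  ∀ M : FDModule Λ, IsIndecomposableModule Λ M.carrier → IsUniserialModule Λ M.carrier

/-- Every homomorphism from `M` to `N` vanishes. -/
def HomZero (Λ : Type) [Ring Λ] (M N : Type) [AddCommGroup M] [Module Λ M]
    [AddCommGroup N] [Module Λ N] : Prop :=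
  ∀ f : M →ₗ[Λ] N, f = 0

section Modules

variable {Λ : Type} [Ring Λ] {M N N' : Type} [AddCommGroup M] [Module Λ M]
  [AddCommGroup N] [Module Λ N] [AddCommGroup N'] [Module Λ N']

theorem HomZero.of_surjective (h : HomZero Λ M N) (g : M →ₗ[Λ] N')
    (hg : Function.Surjective g) : HomZero Λ N' N := fun f => by
  have := h (f ∘ₗ g)
  ext x
  obtain ⟨y, rfl⟩ := hg x
  exact LinearMap.congr_fun this y

theorem HomZero.of_injective (h : HomZero Λ M N) (g : N' →ₗ[Λ] N)
    (hg : Function.Injective g) : HomZero Λ M N' := fun f => by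
  have := h (g ∘ₗ f)
  ext x
  exact hg (by simpa using LinearMap.congr_fun this x)

/-- A map vanishing on the kernel of a surjection factors through it. -/
theorem exists_comp_eq_of_ker_le (a : M →ₗ[Λ] N) (b : M →ₗ[Λ] N') (ha : Function.Surjective a)
    (h : LinearMap.ker a ≤ LinearMap.ker b) : ∃ q : N →ₗ[Λ] N', q ∘ₗ a = b := by
  refine ⟨(LinearMap.ker a).liftQ b h ∘ₗ (a.quotKerEquivOfSurjective ha).symm.toLinearMap, ?_⟩
  ext x
  have e : (a.quotKerEquivOfSurjective ha).symm (a x) = (LinearMap.ker a).mkQ x := by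
    rw [LinearEquiv.symm_apply_eq]; rfl
  simp [e]

theorem HomZero.of_ext_left (π : M →ₗ[Λ] N) (hπ : Function.Surjective π)
    (hK : HomZero Λ (LinearMap.ker π) N') (hN : HomZero Λ N N') : HomZero Λ M N' := fun f => by
  have hle : LinearMap.ker π ≤ LinearMap.ker f := fun x hx => by
    simpa using LinearMap.congr_fun (hK (f ∘ₗ (LinearMap.ker π).subtype)) ⟨x, hx⟩
  obtain ⟨q, rfl⟩ := exists_comp_eq_of_ker_le π f hπ hle
  rw [hN q, LinearMap.zero_comp]

theorem HomZero.of_ext_right (π : M →ₗ[Λ] N)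
    (hK : HomZero Λ N' (LinearMap.ker π)) (hN : HomZero Λ N' N) : HomZero Λ N' M := fun f => by
  have hle : ∀ x, f x ∈ LinearMap.ker π := fun x => by
    simpa using LinearMap.congr_fun (hN (π ∘ₗ f)) x
  have h0 := hK (f.codRestrict _ hle)
  ext x
  simpa using congrArg Subtype.val (LinearMap.congr_fun h0 x)

theorem homZero_of_subsingleton_left [Subsingleton M] : HomZero Λ M N := fun f => by
  ext x; rw [Subsingleton.elim x 0]; simp

theorem homZero_of_subsingleton_right [Subsingleton N] : HomZero Λ M N := fun f => by
  ext x; exact Subsingleton.elim _ _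

theorem exists_ne_zero_of_not_homZero (h : ¬ HomZero Λ M N) : ∃ f : M →ₗ[Λ] N, f ≠ 0 := by
  unfold HomZero at h
  push Not at h
  exact h

theorem not_homZero_self [Nontrivial M] : ¬ HomZero Λ M M := fun h => by
  obtain ⟨x, hx⟩ := exists_ne (0 : M)
  exact hx (LinearMap.congr_fun (h LinearMap.id) x)

theorem not_homZero_of_injective [Nontrivial M] (f : M →ₗ[Λ] N) (hf : Function.Injective f) :
    ¬ HomZero Λ M N := fun h =>
  not_homZero_self (h.of_injective f hf)

theorem not_homZero_of_surjective [Nontrivial N] (f : M →ₗ[Λ] N) (hf : Function.Surjective f) :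
    ¬ HomZero Λ M N := fun h =>
  not_homZero_self (h.of_surjective f hf)

theorem IsUniserialModule.of_injective (h : IsUniserialModule Λ M) (f : N →ₗ[Λ] M)
    (hf : Function.Injective f) : IsUniserialModule Λ N := fun A B => by
  rcases h (A.map f) (B.map f) with h | h
  · exact Or.inl ((Submodule.map_le_map_iff_of_injective hf _ _).1 h)
  · exact Or.inr ((Submodule.map_le_map_iff_of_injective hf _ _).1 h)

theorem IsUniserialModule.of_surjective (h : IsUniserialModule Λ M) (f : M →ₗ[Λ] N)
    (hf : Function.Surjective f) : IsUniserialModule Λ N := fun A B => by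
  rcases h (A.comap f) (B.comap f) with h | h
  · exact Or.inl ((Submodule.comap_le_comap_iff_of_surjective hf).1 h)
  · exact Or.inr ((Submodule.comap_le_comap_iff_of_surjective hf).1 h)

/-- A uniserial module has no proper non-zero direct summand. -/
theorem IsUniserialModule.injective_of_comp_bijective [Nontrivial N]
    (h : IsUniserialModule Λ M) (i : N →ₗ[Λ] M) (g : M →ₗ[Λ] N)
    (hb : Function.Bijective (g ∘ₗ i)) : Function.Injective g := by
  rw [← LinearMap.ker_eq_bot, Submodule.eq_bot_iff]
  rcases h (LinearMap.ker g) (LinearMap.range i) with h | h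
  · intro x hx
    obtain ⟨y, rfl⟩ := h hx
    have : y = 0 := hb.1 (by simpa using hx)
    simp [this]
  · obtain ⟨y, hy⟩ := exists_ne (0 : N)
    exact absurd (hb.1 (by simpa using h (LinearMap.mem_range_self i y))) hy

/-- Dividing the source of `π` by the kernel of a map `φ` defined on the kernel of `π`. -/
theorem exists_quotient_extension (π : M →ₗ[Λ] N) (φ : LinearMap.ker π →ₗ[Λ] N') :
    ∃ (W : Submodule Λ M) (hW : W ≤ LinearMap.ker π)
      (κ : LinearMap.ker (W.liftQ π hW) →ₗ[Λ] N'),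
      Function.Injective κ ∧ LinearMap.range κ = LinearMap.range φ ∧
        (W = ⊥ → Function.Injective φ) := by
  let W := (LinearMap.ker φ).map (LinearMap.ker π).subtype
  have hW : W ≤ LinearMap.ker π := by
    rintro _ ⟨x, -, rfl⟩
    exact x.2
  let p : LinearMap.ker π →ₗ[Λ] LinearMap.ker (W.liftQ π hW) :=
    (W.mkQ ∘ₗ (LinearMap.ker π).subtype).codRestrict _ fun x => by
      simp
  have hp : Function.Surjective p := by
    rintro ⟨y, hy⟩
    obtain ⟨x, rfl⟩ := W.mkQ_surjective y
    exact ⟨⟨x, by simpa using hy⟩, rfl⟩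
  have hker : LinearMap.ker p = LinearMap.ker φ := by
    ext x
    have h1 : p x = 0 ↔ (x : M) ∈ W := by
      rw [← Submodule.Quotient.mk_eq_zero, ← Subtype.coe_inj]; rfl
    rw [LinearMap.mem_ker, h1]
    constructor
    · rintro ⟨y, hy, hyx⟩
      rwa [← Subtype.ext hyx]
    · intro hx
      exact ⟨x, hx, rfl⟩
  obtain ⟨κ, hκ⟩ := exists_comp_eq_of_ker_le p φ hp hker.le
  refine ⟨W, hW, κ, ?_, ?_, ?_⟩
  · rw [← LinearMap.ker_eq_bot, Submodule.eq_bot_iff]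
    intro y hy
    obtain ⟨x, rfl⟩ := hp y
    have : x ∈ LinearMap.ker (κ ∘ₗ p) := hy
    rwa [hκ, ← hker] at this
  · rw [← hκ]
    exact (LinearMap.range_comp_of_range_eq_top κ (LinearMap.range_eq_top.2 hp)).symm
  · intro h
    rw [← LinearMap.ker_eq_bot, Submodule.eq_bot_iff]
    intro x hx
    have : (x : M) ∈ W := ⟨x, hx, rfl⟩
    rw [h] at this
    exact Subtype.ext (by simpa using this)

/-- If the ranges of two injective maps into the same module are comparable, then one source
embeds into the other. -/
theorem exists_injective_of_range_le
    (a : M →ₗ[Λ] N') (b : N →ₗ[Λ] N') (ha : Function.Injective a) (hb : Function.Injective b)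
    (h : LinearMap.range a ≤ LinearMap.range b) :
    ∃ q : M →ₗ[Λ] N, Function.Injective q := by
  exact ⟨(LinearEquiv.ofInjective b hb).symm.toLinearMap ∘ₗ Submodule.inclusion h ∘ₗ
    (LinearEquiv.ofInjective a ha).toLinearMap,
    (LinearEquiv.ofInjective b hb).symm.injective.comp
      ((Submodule.inclusion_injective h).comp (LinearEquiv.ofInjective a ha).injective)⟩

theorem IsBrick.indecomposable {M : FDModule Λ} (h : IsBrick M) :
    IsIndecomposableModule Λ M.carrier := by
  refine ⟨h.1, fun A B hAB => ?_⟩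
  rcases h.2 (A.subtype ∘ₗ A.projectionOnto B hAB) with h0 | h0
  · left
    rw [Submodule.eq_bot_iff]
    intro x hx
    have := LinearMap.congr_fun h0 x
    rw [LinearMap.comp_apply, Submodule.projectionOnto_apply_left hAB ⟨x, hx⟩] at this
    exact this
  · right
    rw [Submodule.eq_bot_iff]
    intro x hx
    refine h0.1 ?_
    rw [LinearMap.comp_apply, Submodule.projectionOnto_apply_right hAB ⟨x, hx⟩, map_zero,
      map_zero]

theorem IsBrick.uniserial (hN : IsNakayama Λ) {M : FDModule Λ} (h : IsBrick M) :
    IsUniserialModule Λ M.carrier :=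
  hN M h.indecomposable

end Modules

section Artinian

variable {Λ : Type} [Ring Λ] [IsArtinianRing Λ]

theorem bijective_of_surjective_of_injective {M N : Type} [AddCommGroup M] [Module Λ M]
    [Module.Finite Λ M] [AddCommGroup N] [Module Λ N] [Module.Finite Λ N]
    (f i : M →ₗ[Λ] N) (hf : Function.Surjective f) (hi : Function.Injective i) :
    Function.Bijective f ∧ Function.Bijective i := by
  have h1 : Function.Bijective f :=
    ⟨IsNoetherian.injective_of_surjective_of_injective i f hi hf, hf⟩
  let e := LinearEquiv.ofBijective f h1
  have h2 := IsArtinian.surjective_of_injective_endomorphism (i ∘ₗ e.symm.toLinearMap)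
    (hi.comp e.symm.injective)
  exact ⟨h1, hi, .of_comp (g := e.symm) h2⟩

/-- Every non-zero finite module has a brick which is both a quotient and a submodule. -/
theorem exists_brick_image (M : Type) [AddCommGroup M] [Module Λ M] [Module.Finite Λ M]
    [Nontrivial M] : ∃ (D : Submodule Λ M) (p : M →ₗ[Λ] D), Function.Surjective p ∧
      IsBrick (FDModule.mk (Λ := Λ) D) := by
  obtain ⟨D, ⟨f, hf, rfl⟩, hmin⟩ := IsArtinian.set_has_minimal
    {D : Submodule Λ M | ∃ f : M →ₗ[Λ] M, f ≠ 0 ∧ LinearMap.range f = D}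
    ⟨_, LinearMap.id, fun h => not_homZero_self (Λ := Λ) (M := M) fun f => by
      rw [← LinearMap.comp_id f, h, LinearMap.comp_zero], rfl⟩
  refine ⟨LinearMap.range f, f.rangeRestrict, f.surjective_rangeRestrict, ?_, fun g => ?_⟩
  · rw [Submodule.nontrivial_iff_ne_bot]
    exact fun h => hf (LinearMap.range_eq_bot.1 h)
  · change LinearMap.range f →ₗ[Λ] LinearMap.range f at g
    by_cases hg : g = 0
    · exact Or.inl hg
    right
    let k := (LinearMap.range f).subtype ∘ₗ g ∘ₗ f.rangeRestrict
    have hk : k ≠ 0 := fun h => hg <| by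
      ext x
      obtain ⟨y, rfl⟩ := f.surjective_rangeRestrict x
      exact LinearMap.congr_fun h y
    have hle : LinearMap.range k ≤ LinearMap.range f := by
      rintro _ ⟨x, rfl⟩
      exact (g (f.rangeRestrict x)).2
    have heq : LinearMap.range k = LinearMap.range f := by
      by_contra hne
      exact hmin _ ⟨k, hk, rfl⟩ (lt_of_le_of_ne hle hne)
    have hs : Function.Surjective g := by
      intro x
      have : (x : M) ∈ LinearMap.range k := heq.ge x.2
      obtain ⟨y, hy⟩ := this
      exact ⟨f.rangeRestrict y, Subtype.ext hy⟩
    exact ⟨IsNoetherian.injective_of_surjective_endomorphism g hs, hs⟩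

/-- Over a Nakayama algebra, of two uniserial modules with a common non-zero quotient, one is a
quotient of the other. -/
theorem IsNakayama.surjective_or_surjective (hN : IsNakayama Λ) {M N X : Type}
    [AddCommGroup M] [Module Λ M] [Module.Finite Λ M] [AddCommGroup N] [Module Λ N]
    [Module.Finite Λ N] [AddCommGroup X] [Module Λ X] [Nontrivial X]
    (hM : IsUniserialModule Λ M) (hN' : IsUniserialModule Λ N)
    (f : M →ₗ[Λ] X) (g : N →ₗ[Λ] X) (hf : Function.Surjective f) (hg : Function.Surjective g) :
    (∃ q : M →ₗ[Λ] N, Function.Surjective q) ∨ ∃ q : N →ₗ[Λ] M, Function.Surjective q := by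
  let Pb : Submodule Λ (M × N) := LinearMap.eqLocus (f ∘ₗ LinearMap.fst Λ M N)
    (g ∘ₗ LinearMap.snd Λ M N)
  obtain ⟨U, ⟨hU, hUM⟩, hmin⟩ := IsArtinian.set_has_minimal
    {U : Submodule Λ (M × N) | U ≤ Pb ∧ U.map (LinearMap.fst Λ M N) = ⊤}
    ⟨Pb, le_rfl, by
      rw [eq_top_iff]
      intro m _
      obtain ⟨n, hn⟩ := hg (f m)
      exact ⟨(m, n), hn.symm, rfl⟩⟩
  let a : U →ₗ[Λ] M := LinearMap.fst Λ M N ∘ₗ U.subtype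
  let b : U →ₗ[Λ] N := LinearMap.snd Λ M N ∘ₗ U.subtype
  have ha : Function.Surjective a := fun m => by
    have : m ∈ U.map (LinearMap.fst Λ M N) := hUM ▸ Submodule.mem_top
    obtain ⟨u, hu, rfl⟩ := this
    exact ⟨⟨u, hu⟩, rfl⟩
  have hab : f ∘ₗ a = g ∘ₗ b := by
    ext u
    exact hU u.2
  have htop : ∀ V : Submodule Λ U, V.map a = ⊤ → V = ⊤ := fun V hV => by
    have hle : V.map U.subtype ≤ U := Submodule.map_subtype_le U V
    have heq : V.map U.subtype = U := by
      by_contra hne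
      refine hmin _ ⟨hle.trans hU, ?_⟩ (lt_of_le_of_ne hle hne)
      rw [← hV, Submodule.map_comp]
    rw [eq_top_iff]
    intro u _
    have : (u : M × N) ∈ V.map U.subtype := heq.ge u.2
    obtain ⟨v, hv, hvu⟩ := this
    rwa [← Subtype.ext hvu]
  have : Nontrivial M := hf.nontrivial
  have hind : IsIndecomposableModule Λ U := by
    refine ⟨ha.nontrivial, fun V₁ V₂ hV => ?_⟩
    have hsup : V₁.map a ⊔ V₂.map a = ⊤ := by
      rw [← Submodule.map_sup, hV.sup_eq_top, Submodule.map_top, LinearMap.range_eq_top.2 ha]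
    rcases hM (V₁.map a) (V₂.map a) with h | h
    · left
      have := htop V₂ (by rwa [sup_eq_right.2 h] at hsup)
      simpa [this] using hV.inf_eq_bot
    · right
      have := htop V₁ (by rwa [sup_eq_left.2 h] at hsup)
      simpa [this] using hV.inf_eq_bot
  have hu := hN (FDModule.mk (Λ := Λ) U) hind
  change IsUniserialModule Λ U at hu
  have hb : Function.Surjective b := by
    rw [← LinearMap.range_eq_top]
    rcases hN' (LinearMap.range b) (LinearMap.ker g) with h | h
    · exfalso
      obtain ⟨x, hx⟩ := exists_ne (0 : X)
      obtain ⟨u, rfl⟩ := hf.comp ha x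
      have h1 := LinearMap.congr_fun hab u
      have h2 : g (b u) = 0 := h (LinearMap.mem_range_self b u)
      exact hx (h1.trans h2)
    · rw [eq_top_iff]
      intro n _
      obtain ⟨u, hu'⟩ := hf.comp ha (g n)
      have h1 := LinearMap.congr_fun hab u
      have h2 : n - b u ∈ LinearMap.ker g := by
        rw [LinearMap.mem_ker, map_sub, sub_eq_zero, ← hu']
        exact h1
      have := Submodule.add_mem _ (h h2) (LinearMap.mem_range_self b u)
      simpa using this
  rcases hu (LinearMap.ker a) (LinearMap.ker b) with h | h
  · obtain ⟨q, hq⟩ := exists_comp_eq_of_ker_le a b ha h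
    exact Or.inl ⟨q, .of_comp (g := a) (by rw [← LinearMap.coe_comp, hq]; exact hb)⟩
  · obtain ⟨q, hq⟩ := exists_comp_eq_of_ker_le b a hb h
    exact Or.inr ⟨q, .of_comp (g := b) (by rw [← LinearMap.coe_comp, hq]; exact ha)⟩

/-- Over a Nakayama algebra, of two uniserial modules with a common non-zero submodule, one embeds
into the other. -/
theorem IsNakayama.injective_or_injective (hN : IsNakayama Λ) {M N X : Type}
    [AddCommGroup M] [Module Λ M] [Module.Finite Λ M] [AddCommGroup N] [Module Λ N]
    [Module.Finite Λ N] [AddCommGroup X] [Module Λ X] [Nontrivial X]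
    (hM : IsUniserialModule Λ M) (hN' : IsUniserialModule Λ N)
    (f : X →ₗ[Λ] M) (g : X →ₗ[Λ] N) (hf : Function.Injective f) (hg : Function.Injective g) :
    (∃ q : M →ₗ[Λ] N, Function.Injective q) ∨ ∃ q : N →ₗ[Λ] M, Function.Injective q := by
  let i : M →ₗ[Λ] M × N := LinearMap.inl Λ M N
  let j : N →ₗ[Λ] M × N := LinearMap.inr Λ M N
  let R : Submodule Λ (M × N) := LinearMap.range (f.prod (-g))
  obtain ⟨W, ⟨hRW, hWM⟩, hmax⟩ := set_has_maximal_iff_noetherian.2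
    (inferInstance : IsNoetherian Λ (M × N))
    {W : Submodule Λ (M × N) | R ≤ W ∧ W.comap i = ⊥}
    ⟨R, le_rfl, by
      refine (Submodule.eq_bot_iff _).2 ?_
      rintro m ⟨x, hx⟩
      have h1 : f x = m := congrArg Prod.fst hx
      have h2 : -g x = 0 := congrArg Prod.snd hx
      have : x = 0 := hg (by simpa using h2)
      simp [← h1, this]⟩
  let a : M →ₗ[Λ] (M × N) ⧸ W := W.mkQ ∘ₗ i
  let b : N →ₗ[Λ] (M × N) ⧸ W := W.mkQ ∘ₗ j
  have ha : Function.Injective a := by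
    rw [← LinearMap.ker_eq_bot, LinearMap.ker_comp, Submodule.ker_mkQ, hWM]
  have hab : a ∘ₗ f = b ∘ₗ g := by
    ext x
    refine (Submodule.Quotient.eq W).2 (hRW ⟨x, ?_⟩)
    simp [i, j]
  have hbot : ∀ V : Submodule Λ ((M × N) ⧸ W), V.comap a = ⊥ → V = ⊥ := fun V hV => by
    have hle : W ≤ V.comap W.mkQ := fun w hw => by
      have : W.mkQ w = 0 := by simpa using hw
      simp [this]
    have heq : W = V.comap W.mkQ := by
      by_contra hne
      exact hmax _ ⟨hRW.trans hle, by rw [← hV]; rfl⟩ (lt_of_le_of_ne hle hne)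
    rw [Submodule.eq_bot_iff]
    intro v hv
    obtain ⟨w, rfl⟩ := W.mkQ_surjective v
    have : w ∈ W := heq ▸ hv
    simpa using this
  have : Nontrivial M := hf.nontrivial
  have hind : IsIndecomposableModule Λ ((M × N) ⧸ W) := by
    refine ⟨ha.nontrivial, fun V₁ V₂ hV => ?_⟩
    have hinf : V₁.comap a ⊓ V₂.comap a = ⊥ := by
      rw [← Submodule.comap_inf, hV.inf_eq_bot, Submodule.comap_bot, LinearMap.ker_eq_bot.2 ha]
    rcases hM (V₁.comap a) (V₂.comap a) with h | h
    · exact Or.inl (hbot _ (by rwa [inf_eq_left.2 h] at hinf))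
    · exact Or.inr (hbot _ (by rwa [inf_eq_right.2 h] at hinf))
  have hu := hN (FDModule.mk (Λ := Λ) ((M × N) ⧸ W)) hind
  change IsUniserialModule Λ ((M × N) ⧸ W) at hu
  have hb : Function.Injective b := by
    rw [← LinearMap.ker_eq_bot]
    rcases hN' (LinearMap.ker b) (LinearMap.range g) with h | h
    · rw [Submodule.eq_bot_iff]
      intro n hn
      obtain ⟨x, rfl⟩ := h hn
      have h1 := LinearMap.congr_fun hab x
      have h2 : a (f x) = 0 := h1.trans hn
      have : x = 0 := hf (ha (by simpa using h2))
      simp [this]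
    · exfalso
      obtain ⟨x, hx⟩ := exists_ne (0 : X)
      have h1 := LinearMap.congr_fun hab x
      have h2 : a (f x) = 0 := h1.trans (h (LinearMap.mem_range_self g x))
      exact hx (hf (ha (by simpa using h2)))
  rcases hu (LinearMap.range a) (LinearMap.range b) with h | h
  · exact Or.inl (exists_injective_of_range_le a b ha hb h)
  · exact Or.inr (exists_injective_of_range_le b a hb ha h)

end Artinian

section Lists

variable {Λ : Type} [Ring Λ] [IsArtinianRing Λ]

omit [IsArtinianRing Λ] in
theorem listBHO_append_iff {l₁ l₂ : List (FDModule Λ)} :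
    ListBHO (l₁ ++ l₂) ↔ ListBHO l₁ ∧ ListBHO l₂ ∧
      ∀ A ∈ l₁, ∀ B ∈ l₂, HomZero Λ B.carrier A.carrier :=
  List.pairwise_append

omit [IsArtinianRing Λ] in
theorem listBHO_cons_iff {A : FDModule Λ} {l : List (FDModule Λ)} :
    ListBHO (A :: l) ↔ (∀ B ∈ l, HomZero Λ B.carrier A.carrier) ∧ ListBHO l :=
  List.pairwise_cons

omit [IsArtinianRing Λ] in
theorem listBHO_insert_iff {l₁ l₂ : List (FDModule Λ)} (h : ListBHO (l₁ ++ l₂))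
    {C : FDModule Λ} : ListBHO (l₁ ++ C :: l₂) ↔
      (∀ Z ∈ l₁, HomZero Λ C.carrier Z.carrier) ∧ ∀ Z ∈ l₂, HomZero Λ Z.carrier C.carrier := by
  rw [listBHO_append_iff] at h
  rw [listBHO_append_iff, listBHO_cons_iff]
  constructor
  · rintro ⟨-, ⟨h2, -⟩, h3⟩
    exact ⟨fun Z hZ => h3 Z hZ C List.mem_cons_self, h2⟩
  · rintro ⟨h1, h2⟩
    refine ⟨h.1, ⟨h2, h.2.1⟩, fun A hA B hB => ?_⟩
    rcases List.mem_cons.1 hB with rfl | hB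
    · exact h1 A hA
    · exact h.2.2 A hA B hB

omit [IsArtinianRing Λ] in
theorem isMaxBHOList_iff {l : List (FDModule Λ)} : IsMaxBHOList l ↔
    (∀ M ∈ l, IsBrick M) ∧ ListBHO l ∧ ∀ C : FDModule Λ, IsBrick C →
      ∀ l₁ l₂ : List (FDModule Λ), l = l₁ ++ l₂ →
        (∀ Z ∈ l₁, HomZero Λ C.carrier Z.carrier) →
          (∀ Z ∈ l₂, HomZero Λ Z.carrier C.carrier) → False := by
  refine and_congr_right fun _ => and_congr_right fun hl => forall₂_congr fun C _ =>
    forall₃_congr fun l₁ l₂ h => ?_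
  subst h
  rw [listBHO_insert_iff hl, not_and]

/-- The torsion and torsion-free classes cut out by a maximal list meet in zero. -/
theorem IsMaxBHOList.subsingleton {l₁ l₂ : List (FDModule Λ)} (h : IsMaxBHOList (l₁ ++ l₂))
    {M : Type} [AddCommGroup M] [Module Λ M] [Module.Finite Λ M]
    (h1 : ∀ Z ∈ l₁, HomZero Λ M Z.carrier) (h2 : ∀ Z ∈ l₂, HomZero Λ Z.carrier M) :
    Subsingleton M := by
  by_contra hM
  rw [not_subsingleton_iff_nontrivial] at hM
  obtain ⟨D, p, hp, hD⟩ := exists_brick_image (Λ := Λ) M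
  exact (isMaxBHOList_iff.1 h).2.2 _ hD l₁ l₂ rfl (fun Z hZ => (h1 Z hZ).of_surjective p hp)
    fun Z hZ => (h2 Z hZ).of_injective D.subtype D.injective_subtype

variable {L S R : List (FDModule Λ)} {B : FDModule Λ} {M : Type} [AddCommGroup M] [Module Λ M]
  [Module.Finite Λ M]

theorem IsMaxBHOList.not_homZero_left [Nontrivial M] (h : IsMaxBHOList (L ++ B :: R))
    (h1 : ∀ Z ∈ L, HomZero Λ M Z.carrier) (h2 : ∀ Z ∈ R, HomZero Λ Z.carrier M) :
    ¬ HomZero Λ M B.carrier := fun hB => by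
  rw [List.append_cons] at h
  refine not_subsingleton M (h.subsingleton (fun Z hZ => ?_) h2)
  rcases List.mem_append.1 hZ with hZ | hZ
  · exact h1 Z hZ
  · rwa [List.mem_singleton.1 hZ]

theorem IsMaxBHOList.not_homZero_right [Nontrivial M] (h : IsMaxBHOList (L ++ B :: R))
    (h1 : ∀ Z ∈ L, HomZero Λ M Z.carrier) (h2 : ∀ Z ∈ R, HomZero Λ Z.carrier M) :
    ¬ HomZero Λ B.carrier M := fun hB =>
  not_subsingleton M (h.subsingleton h1 (List.forall_mem_cons.2 ⟨hB, h2⟩))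

omit [IsArtinianRing Λ] in
theorem IsMaxBHOList.homZero (h : IsMaxBHOList (L ++ R)) {A C : FDModule Λ} (hA : A ∈ L)
    (hC : C ∈ R) : HomZero Λ C.carrier A.carrier :=
  (listBHO_append_iff.1 h.2.1).2.2 A hA C hC

omit [IsArtinianRing Λ] in
theorem IsMaxBHOList.homZero_tail (h : IsMaxBHOList (L ++ B :: R)) {C : FDModule Λ}
    (hC : C ∈ R) : HomZero Λ C.carrier B.carrier :=
  (listBHO_cons_iff.1 (listBHO_append_iff.1 h.2.1).2.1).1 C hC

omit [IsArtinianRing Λ] in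
theorem IsMaxBHOList.isBrick (h : IsMaxBHOList (L ++ B :: R)) : IsBrick B :=
  h.1 B (by simp)

theorem IsMaxBHOList.surjective (h : IsMaxBHOList (L ++ B :: R))
    (h1 : ∀ Z ∈ L, HomZero Λ M Z.carrier) (f : M →ₗ[Λ] B.carrier) (hf : f ≠ 0) :
    Function.Surjective f := by
  have : Nontrivial (LinearMap.range f) := by
    rw [Submodule.nontrivial_iff_ne_bot]
    exact fun h => hf (LinearMap.range_eq_bot.1 h)
  obtain ⟨g, hg⟩ := exists_ne_zero_of_not_homZero <| h.not_homZero_right (M := LinearMap.range f)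
    (fun Z hZ => (h1 Z hZ).of_surjective _ f.surjective_rangeRestrict)
    (fun Z hZ => (h.homZero_tail hZ).of_injective _ (LinearMap.range f).injective_subtype)
  rcases h.isBrick.2 ((LinearMap.range f).subtype ∘ₗ g) with h0 | h0
  · refine absurd ?_ hg
    ext x
    exact LinearMap.congr_fun h0 x
  · intro y
    obtain ⟨x, rfl⟩ := h0.2 y
    exact (g x).2

omit [Module.Finite Λ M] in
theorem IsMaxBHOList.injective (h : IsMaxBHOList (L ++ B :: R))
    (h2 : ∀ Z ∈ R, HomZero Λ Z.carrier M) (f : B.carrier →ₗ[Λ] M) (hf : f ≠ 0) :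
    Function.Injective f := by
  have : Nontrivial (LinearMap.range f) := by
    rw [Submodule.nontrivial_iff_ne_bot]
    exact fun h => hf (LinearMap.range_eq_bot.1 h)
  obtain ⟨g, hg⟩ := exists_ne_zero_of_not_homZero <| h.not_homZero_left (M := LinearMap.range f)
    (fun Z hZ => (h.homZero hZ List.mem_cons_self).of_surjective _ f.surjective_rangeRestrict)
    (fun Z hZ => (h2 Z hZ).of_injective _ (LinearMap.range f).injective_subtype)
  rcases h.isBrick.2 (g ∘ₗ f.rangeRestrict) with h0 | h0
  · refine absurd ?_ hg
    ext x
    obtain ⟨y, rfl⟩ := f.surjective_rangeRestrict x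
    exact LinearMap.congr_fun h0 y
  · intro x y hxy
    exact h0.1 (congrArg g (Subtype.ext hxy : f.rangeRestrict x = f.rangeRestrict y))

theorem IsMaxBHOList.exists_surjective [Nontrivial M] (h : IsMaxBHOList (L ++ (S ++ R)))
    (h1 : ∀ Z ∈ L, HomZero Λ M Z.carrier) (h2 : ∀ Z ∈ R, HomZero Λ Z.carrier M) :
    ∃ B ∈ S, ∃ f : M →ₗ[Λ] B.carrier, Function.Surjective f := by
  induction S generalizing L with
  | nil => exact absurd (h.subsingleton h1 h2) (not_subsingleton M)
  | cons B S ih =>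
    by_cases hB : HomZero Λ M B.carrier
    · obtain ⟨C, hC, hf⟩ := ih (L := L ++ [B]) (by simpa using h) (by
        simpa [or_imp, forall_and] using ⟨h1, hB⟩)
      exact ⟨C, List.mem_cons_of_mem _ hC, hf⟩
    · obtain ⟨f, hf⟩ := exists_ne_zero_of_not_homZero hB
      exact ⟨B, List.mem_cons_self, f, IsMaxBHOList.surjective h h1 f hf⟩

theorem IsMaxBHOList.exists_injective [Nontrivial M] (h : IsMaxBHOList (L ++ (S ++ R)))
    (h1 : ∀ Z ∈ L, HomZero Λ M Z.carrier) (h2 : ∀ Z ∈ R, HomZero Λ Z.carrier M) :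
    ∃ B ∈ S, ∃ f : B.carrier →ₗ[Λ] M, Function.Injective f := by
  induction S using List.reverseRecOn generalizing R with
  | nil => exact absurd (h.subsingleton h1 h2) (not_subsingleton M)
  | append_singleton S B ih =>
    by_cases hB : HomZero Λ B.carrier M
    · obtain ⟨C, hC, hf⟩ := ih (R := B :: R) (by simpa using h)
        (List.forall_mem_cons.2 ⟨hB, h2⟩)
      exact ⟨C, List.mem_append_left _ hC, hf⟩
    · obtain ⟨f, hf⟩ := exists_ne_zero_of_not_homZero hB
      refine ⟨B, by simp, f, IsMaxBHOList.injective (L := L ++ S) (R := R) (by simpa using h)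
        h2 f hf⟩

/-- The torsion submodule of a module with respect to the torsion pair cut out by two lists. -/
theorem exists_torsion_submodule {l₁ l₂ : List (FDModule Λ)}
    (h : ∀ A ∈ l₁, ∀ B ∈ l₂, HomZero Λ B.carrier A.carrier) (D : Type) [AddCommGroup D]
    [Module Λ D] [Module.Finite Λ D] :
    ∃ V : Submodule Λ D, (∀ Z ∈ l₁, HomZero Λ (LinearMap.ker V.mkQ) Z.carrier) ∧
      ∀ Z ∈ l₂, HomZero Λ Z.carrier (D ⧸ V) := by
  obtain ⟨V, hV, hmin⟩ := IsArtinian.set_has_minimal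
    {V : Submodule Λ D | ∀ Z ∈ l₂, HomZero Λ Z.carrier (D ⧸ V)}
    ⟨⊤, fun Z _ => homZero_of_subsingleton_right⟩
  refine ⟨V, fun Z hZ φ => ?_, hV⟩
  obtain ⟨W, hW, κ, hκ, hr, -⟩ := exists_quotient_extension V.mkQ φ
  have hWV : W ≤ V := by rwa [Submodule.ker_mkQ] at hW
  have heq : W = V := by
    by_contra hne
    exact hmin W (fun Z' hZ' => HomZero.of_ext_right (W.liftQ V.mkQ hW)
      ((h Z hZ Z' hZ').of_injective κ hκ) (hV Z' hZ')) (lt_of_le_of_ne hWV hne)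
  have hk : LinearMap.ker (W.liftQ V.mkQ hW) = ⊥ := by
    rw [Submodule.ker_liftQ, Submodule.ker_mkQ, heq, Submodule.mkQ_map_self]
  rw [← LinearMap.range_eq_bot, ← hr, Submodule.eq_bot_iff]
  rintro _ ⟨x, rfl⟩
  have : x = 0 := Subtype.ext ((Submodule.mem_bot Λ).1 (hk.le x.2))
  rw [this, map_zero]

end Lists

section Cuts

variable {Λ : Type} [Ring Λ] [IsArtinianRing Λ]

/-- A maximal list excludes uniserial extensions of `Y` by an entry `X` when `Y` is orthogonal
to `X` and to all entries before `X`, and every entry after `X` is orthogonal to `Y` or `X`. -/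
theorem IsMaxBHOList.no_extension {P R : List (FDModule Λ)} {X : FDModule Λ}
    (h : IsMaxBHOList (P ++ X :: R)) {E Y : Type} [AddCommGroup E] [Module Λ E]
    [Module.Finite Λ E] [AddCommGroup Y] [Module Λ Y] [Nontrivial Y]
    (hE : IsUniserialModule Λ E) (π : E →ₗ[Λ] Y) (hπ : Function.Surjective π)
    (κ : LinearMap.ker π →ₗ[Λ] X.carrier) (hκ : Function.Bijective κ)
    (hYX : HomZero Λ Y X.carrier) (hP : ∀ Z ∈ P, HomZero Λ Y Z.carrier)
    (hR : ∀ Z ∈ R, HomZero Λ Z.carrier Y ∨ HomZero Λ X.carrier Z.carrier) : False := by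
  have : Nontrivial X.carrier := h.isBrick.1
  have : Nontrivial E := hπ.nontrivial
  let e := LinearEquiv.ofBijective κ hκ
  let ι : X.carrier →ₗ[Λ] E := (LinearMap.ker π).subtype ∘ₗ e.symm.toLinearMap
  have hι : Function.Injective ι :=
    (LinearMap.ker π).injective_subtype.comp e.symm.injective
  have hr : LinearMap.range ι = LinearMap.ker π := by
    rw [LinearMap.range_comp, LinearEquiv.range, Submodule.map_top, Submodule.range_subtype]
  have hEP : ∀ Z ∈ P, HomZero Λ E Z.carrier := fun Z hZ =>
    HomZero.of_ext_left π hπ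
      ((h.homZero hZ List.mem_cons_self).of_surjective e.symm.toLinearMap e.symm.surjective)
      (hP Z hZ)
  by_cases hEX : HomZero Λ E X.carrier
  · obtain ⟨Z, hZ, z, hz⟩ := IsMaxBHOList.exists_injective (L := P ++ [X]) (S := R) (R := [])
      (M := E) (by simpa using h) (by simpa [or_imp, forall_and] using ⟨hEP, hEX⟩) (by simp)
    rcases hE (LinearMap.range z) (LinearMap.range ι) with hc | hc
    · obtain ⟨q, hq⟩ := exists_injective_of_range_le z ι hz hι hc
      have : Nontrivial Z.carrier := (h.1 Z (by simp [hZ])).1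
      exact not_homZero_of_injective q hq (h.homZero_tail hZ)
    · obtain ⟨q, hq⟩ := exists_injective_of_range_le ι z hι hz hc
      rcases hR Z hZ with h0 | h0
      · have h1 : LinearMap.range z ≤ LinearMap.range ι := by
          rw [hr]
          rintro _ ⟨x, rfl⟩
          exact LinearMap.congr_fun (h0 (π ∘ₗ z)) x
        obtain ⟨q', hq'⟩ := exists_injective_of_range_le z ι hz hι h1
        have : Nontrivial Z.carrier := (h.1 Z (by simp [hZ])).1
        exact not_homZero_of_injective q' hq' (h.homZero_tail hZ)
      · exact not_homZero_of_injective q hq h0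
  · obtain ⟨g, hg⟩ := exists_ne_zero_of_not_homZero hEX
    rcases h.isBrick.2 (g ∘ₗ ι) with h0 | h0
    · have hle : LinearMap.ker π ≤ LinearMap.ker g := by
        rw [← hr]
        rintro _ ⟨x, rfl⟩
        exact LinearMap.congr_fun h0 x
      obtain ⟨q, rfl⟩ := exists_comp_eq_of_ker_le π g hπ hle
      exact hg (by rw [hYX q, LinearMap.zero_comp])
    · have hgi := hE.injective_of_comp_bijective ι g h0
      obtain ⟨y, hy⟩ := exists_ne (0 : Y)
      obtain ⟨x, rfl⟩ := hπ y
      obtain ⟨w, hw⟩ := h0.2 (g x)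
      have hx : x ∈ LinearMap.range ι := ⟨w, hgi hw⟩
      rw [hr] at hx
      exact hy hx

/-- After moving `Y` past `S`, the cut just before `Y` admits no uniserial module. -/
theorem IsMaxBHOList.false_of_middle_cut {L S M P R : List (FDModule Λ)} {X Y : FDModule Λ}
    (hG : IsMaxBHOList (L ++ Y :: (S ++ M))) (hG' : IsMaxBHOList (P ++ X :: R))
    (hPL : P ⊆ L) (hR : R ⊆ L ++ Y :: (S ++ M)) (hX : X ∈ S ++ M)
    (hYX : HomZero Λ Y.carrier X.carrier) (hS : ∀ B ∈ S, ¬ HomZero Λ B.carrier X.carrier)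
    {D : Type} [AddCommGroup D] [Module Λ D] [Module.Finite Λ D] [Nontrivial D]
    (hD : IsUniserialModule Λ D) (hDL : ∀ Z ∈ L, HomZero Λ D Z.carrier)
    (hDS : HomZero Λ D Y.carrier → ∀ Z ∈ S, HomZero Λ D Z.carrier) (hYD : HomZero Λ Y.carrier D)
    (hMD : ∀ Z ∈ M, HomZero Λ Z.carrier D) : False := by
  have hG1 : IsMaxBHOList ((L ++ [Y]) ++ (S ++ M)) := by simpa using hG
  have hLY : ∀ Z ∈ L ++ [Y], ∀ B ∈ S ++ M, HomZero Λ B.carrier Z.carrier := fun Z hZ B hB =>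
    hG1.homZero hZ hB
  obtain ⟨V, hV1, hV2⟩ := exists_torsion_submodule hLY D
  have : Nontrivial Y.carrier := hG.isBrick.1
  have : Nontrivial X.carrier := hG'.isBrick.1
  have hT : Nontrivial (LinearMap.ker V.mkQ) := by
    by_contra hT
    rw [not_nontrivial_iff_subsingleton] at hT
    refine not_subsingleton D (hG.subsingleton hDL (List.forall_mem_cons.2 ⟨hYD, fun Z hZ => ?_⟩))
    exact HomZero.of_ext_right V.mkQ homZero_of_subsingleton_right (hV2 Z hZ)
  obtain ⟨B, hB, f, hf⟩ := hG1.exists_surjective hV1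
    fun Z hZ => (hMD Z hZ).of_injective _ (LinearMap.ker V.mkQ).injective_subtype
  obtain ⟨b, hb⟩ := exists_ne_zero_of_not_homZero (hS B hB)
  have hφ := hG'.surjective (fun Z hZ => hV1 Z (List.mem_append_left _ (hPL hZ))) (b ∘ₗ f)
    fun h0 => hb <| by
      ext x
      obtain ⟨x, rfl⟩ := hf x
      exact LinearMap.congr_fun h0 x
  have hU : Nontrivial (D ⧸ V) := by
    by_contra hU
    rw [not_nontrivial_iff_subsingleton] at hU
    have hG2 : IsMaxBHOList ((L ++ Y :: S) ++ M) := by simpa using hG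
    have hDY : HomZero Λ D Y.carrier := HomZero.of_ext_left V.mkQ V.mkQ_surjective
      (hV1 Y (by simp)) homZero_of_subsingleton_left
    refine not_subsingleton D (hG2.subsingleton (fun Z hZ => ?_) hMD)
    rcases List.mem_append.1 hZ with hZ | hZ
    · exact hDL Z hZ
    rcases List.mem_cons.1 hZ with rfl | hZ
    · exact hDY
    · exact hDS hDY Z hZ
  obtain ⟨y, hy⟩ := exists_ne_zero_of_not_homZero <| hG.not_homZero_right (M := D ⧸ V)
    (fun Z hZ => (hDL Z hZ).of_surjective _ V.mkQ_surjective) hV2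
  replace hy := hG.injective hV2 y hy
  let D' := (LinearMap.range y).comap V.mkQ
  let e := LinearEquiv.ofInjective y hy
  let p : D' →ₗ[Λ] LinearMap.range y := (V.mkQ ∘ₗ D'.subtype).codRestrict _ fun x => x.2
  have hp : Function.Surjective p := by
    rintro ⟨u, hu⟩
    obtain ⟨x, rfl⟩ := V.mkQ_surjective u
    exact ⟨⟨x, hu⟩, rfl⟩
  let π : D' →ₗ[Λ] Y.carrier := e.symm.toLinearMap ∘ₗ p
  have hπ : Function.Surjective π := e.symm.surjective.comp hp
  have hker : ∀ x : D', x ∈ LinearMap.ker π ↔ (x : D) ∈ LinearMap.ker V.mkQ := fun x => by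
    rw [LinearMap.mem_ker, LinearMap.mem_ker, LinearMap.comp_apply, LinearEquiv.coe_coe,
      LinearEquiv.map_eq_zero_iff, ← Subtype.coe_inj]
    rfl
  let j : LinearMap.ker π →ₗ[Λ] LinearMap.ker V.mkQ :=
    (D'.subtype ∘ₗ (LinearMap.ker π).subtype).codRestrict _ fun x => (hker x).1 x.2
  have hj : Function.Surjective j := by
    rintro ⟨x, hx⟩
    have hx' : x ∈ D' := by
      change V.mkQ x ∈ LinearMap.range y
      rw [LinearMap.mem_ker.1 hx]
      exact Submodule.zero_mem _
    exact ⟨⟨⟨x, hx'⟩, (hker _).2 hx⟩, rfl⟩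
  obtain ⟨W, hW, κ, hκ, hr, -⟩ := exists_quotient_extension π ((b ∘ₗ f) ∘ₗ j)
  refine hG'.no_extension (E := D' ⧸ W) (Y := Y.carrier)
    ((hD.of_injective _ D'.injective_subtype).of_surjective _ W.mkQ_surjective)
    (W.liftQ π hW) ?_ κ ⟨hκ, ?_⟩ hYX (fun Z hZ => hG.homZero (hPL hZ) List.mem_cons_self)
    fun Z hZ => ?_
  · intro x
    obtain ⟨x, rfl⟩ := hπ x
    exact ⟨W.mkQ x, rfl⟩
  · rw [← LinearMap.range_eq_top, hr, LinearMap.range_eq_top]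
    exact hφ.comp hj
  · rcases List.mem_append.1 (hR hZ) with h0 | h0
    · exact Or.inr (hLY Z (by simp [h0]) X hX)
    · rcases List.mem_cons.1 h0 with rfl | h0
      · exact Or.inr (hLY Z (by simp) X hX)
      · exact Or.inl (hG.homZero_tail h0)

end Cuts

section Pentagon

variable {Λ : Type} [Ring Λ] [IsArtinianRing Λ]

/-- Adjacent bricks `Y, F, F'` of a maximal list with a non-zero map from `Y` to `F` and a
surjection from `F` to `F'` form a short exact sequence. -/
theorem IsMaxBHOList.ker_equiv (hN : IsNakayama Λ) {L M : List (FDModule Λ)}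
    {X Y F F' : FDModule Λ} (h : IsMaxBHOList (L ++ Y :: F :: F' :: M))
    (hYF : ¬ HomZero Λ Y.carrier F.carrier) (q : F.carrier →ₗ[Λ] F'.carrier)
    (hq : Function.Surjective q) (hYX : HomZero Λ Y.carrier X.carrier)
    (hFX : ¬ HomZero Λ F.carrier X.carrier) (hFX' : ¬ HomZero Λ F'.carrier X.carrier) :
    HomZero Λ Y.carrier F'.carrier ∧ Nonempty (LinearMap.ker q ≃ₗ[Λ] Y.carrier) := by
  have hF1 : IsMaxBHOList ((L ++ [Y]) ++ F :: F' :: M) := by simpa using h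
  have hF2 : IsMaxBHOList ((L ++ [Y, F]) ++ F' :: M) := by simpa using h
  have : Nontrivial Y.carrier := h.isBrick.1
  have : Nontrivial F.carrier := hF1.isBrick.1
  have : Nontrivial F'.carrier := hF2.isBrick.1
  have hrange : ∀ {B : FDModule Λ} (f : Y.carrier →ₗ[Λ] B.carrier), f ≠ 0 →
      Nontrivial (LinearMap.range f) := fun f hf => by
    rw [Submodule.nontrivial_iff_ne_bot]
    exact fun h => hf (LinearMap.range_eq_bot.1 h)
  have hrangeL : ∀ {B : FDModule Λ} (f : Y.carrier →ₗ[Λ] B.carrier), ∀ Z ∈ L,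
      HomZero Λ (LinearMap.range f) Z.carrier := fun f Z hZ =>
    (h.homZero hZ List.mem_cons_self).of_surjective _ f.surjective_rangeRestrict
  have hsurj : ∀ {B : FDModule Λ} (f : Y.carrier →ₗ[Λ] B.carrier)
      (i : B.carrier →ₗ[Λ] LinearMap.range f), Function.Injective i →
      HomZero Λ B.carrier X.carrier := fun f i hi => by
    refine hYX.of_surjective f fun x => ?_
    obtain ⟨z, rfl⟩ := IsArtinian.surjective_of_injective_endomorphism
      ((LinearMap.range f).subtype ∘ₗ i) ((LinearMap.range f).injective_subtype.comp hi) x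
    exact (i z).2
  have hinj : ∀ {B : FDModule Λ} (f : Y.carrier →ₗ[Λ] B.carrier)
      (i : Y.carrier →ₗ[Λ] LinearMap.range f), Function.Injective i →
      Function.Injective f := fun f i hi =>
    (LinearMap.range f).injective_subtype.comp
      (bijective_of_surjective_of_injective _ i f.surjective_rangeRestrict hi).1.1
  have hYF1 : ∀ f : Y.carrier →ₗ[Λ] F.carrier, f ≠ 0 → Function.Injective f := fun f hf => by
    have := hrange f hf
    obtain ⟨B, hB, i, hi⟩ := IsMaxBHOList.exists_injective (L := L) (S := [Y, F]) (R := F' :: M)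
      h (hrangeL f)
      fun Z hZ => (hF1.homZero_tail hZ).of_injective _ (LinearMap.range f).injective_subtype
    simp only [List.mem_cons, List.not_mem_nil, or_false] at hB
    rcases hB with rfl | rfl
    · exact hinj f i hi
    · exact absurd (hsurj f i hi) hFX
  have hnot : ∀ i : F.carrier →ₗ[Λ] F'.carrier, ¬ Function.Injective i := fun i hi => by
    let e := LinearEquiv.ofBijective q (bijective_of_surjective_of_injective q i hq hi).1
    exact not_homZero_of_injective e.symm.toLinearMap e.symm.injective
      (hF1.homZero_tail (by simp))
  obtain ⟨f, hf⟩ := exists_ne_zero_of_not_homZero hYF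
  have hfi := hYF1 f hf
  have hYF' : HomZero Λ Y.carrier F'.carrier := fun g => by
    by_contra hg
    have := hrange g hg
    obtain ⟨B, hB, i, hi⟩ := IsMaxBHOList.exists_injective (L := L) (S := [Y, F, F']) (R := M)
      h (hrangeL g)
      fun Z hZ => (hF2.homZero_tail hZ).of_injective _ (LinearMap.range g).injective_subtype
    simp only [List.mem_cons, List.not_mem_nil, or_false] at hB
    rcases hB with rfl | rfl | rfl
    · rcases hN.injective_or_injective (hF1.isBrick.uniserial hN) (hF2.isBrick.uniserial hN)
        f g hfi (hinj g i hi) with ⟨k, hk⟩ | ⟨k, hk⟩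
      · exact hnot k hk
      · exact not_homZero_of_injective k hk (hF1.homZero_tail (by simp))
    · exact hnot ((LinearMap.range g).subtype ∘ₗ i) ((LinearMap.range g).injective_subtype.comp hi)
    · exact hFX' (hsurj g i hi)
  refine ⟨hYF', ?_⟩
  have hK : ∀ Z ∈ L ++ [Y], ∀ g : LinearMap.ker q →ₗ[Λ] Z.carrier, g ≠ 0 →
      Function.Injective g := fun Z hZ g hg => by
    obtain ⟨W, hW, κ, hκ, hr, hbot⟩ := exists_quotient_extension q g
    have hFL : ∀ Z ∈ L ++ [Y], HomZero Λ (F.carrier ⧸ W) Z.carrier := fun Z hZ =>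
      (hF1.homZero hZ List.mem_cons_self).of_surjective _ W.mkQ_surjective
    have hqb : Function.Surjective (W.liftQ q hW) := fun x => by
      obtain ⟨x, rfl⟩ := hq x
      exact ⟨W.mkQ x, rfl⟩
    have : Nontrivial (F.carrier ⧸ W) := hqb.nontrivial
    by_cases hF : HomZero Λ (F.carrier ⧸ W) F.carrier
    · exfalso
      obtain ⟨t, ht⟩ := exists_ne_zero_of_not_homZero <|
        hF2.not_homZero_right (M := F.carrier ⧸ W) (fun Z hZ => by
          simp only [List.mem_append, List.mem_cons, List.not_mem_nil, or_false] at hZ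
          rcases hZ with hZ | rfl | rfl
          · exact hFL Z (by simp [hZ])
          · exact hFL _ (by simp)
          · exact hF) fun B hB => HomZero.of_ext_right (W.liftQ q hW)
            (HomZero.of_injective (hF1.homZero hZ (by simp [hB])) κ hκ) (hF2.homZero_tail hB)
      rcases hF2.isBrick.2 (W.liftQ q hW ∘ₗ t) with h0 | h0
      · refine ht ?_
        have h1 := HomZero.of_injective (hF1.homZero (C := F') hZ (by simp)) κ hκ
        have h2 := h1 (t.codRestrict _ fun x => LinearMap.congr_fun h0 x)
        ext x
        exact congrArg Subtype.val (LinearMap.congr_fun h2 x)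
      · have hi := ((hF1.isBrick.uniserial hN).of_surjective W.mkQ
          W.mkQ_surjective).injective_of_comp_bijective t _ h0
        refine hg ?_
        rw [← LinearMap.range_eq_bot, ← hr, Submodule.eq_bot_iff]
        rintro _ ⟨x, rfl⟩
        have : x = 0 := Subtype.ext (hi (by simp))
        rw [this, map_zero]
    · obtain ⟨t, ht⟩ := exists_ne_zero_of_not_homZero hF
      have hs := (hF1.surjective hFL t ht).comp W.mkQ_surjective
      have hi := IsNoetherian.injective_of_surjective_endomorphism (t ∘ₗ W.mkQ) hs
      refine hbot ?_
      rw [← W.ker_mkQ, LinearMap.ker_eq_bot]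
      exact .of_comp (f := t) hi
  let y : Y.carrier →ₗ[Λ] LinearMap.ker q := f.codRestrict _ fun x =>
    LinearMap.congr_fun (hYF' (q ∘ₗ f)) x
  have hy : Function.Injective y := fun a b hab => hfi (congrArg Subtype.val hab)
  have : Nontrivial (LinearMap.ker q) := hy.nontrivial
  obtain ⟨B, hB, s, hs⟩ := IsMaxBHOList.exists_surjective (L := L) (S := [Y, F]) (R := F' :: M)
    (M := LinearMap.ker q) h (fun Z hZ => by
      by_contra hKZ
      obtain ⟨g, hg⟩ := exists_ne_zero_of_not_homZero hKZ
      exact not_homZero_of_injective (g ∘ₗ y) ((hK Z (by simp [hZ]) g hg).comp hy)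
        (h.homZero hZ List.mem_cons_self))
    fun Z hZ => (hF1.homZero_tail hZ).of_injective _ (LinearMap.ker q).injective_subtype
  simp only [List.mem_cons, List.not_mem_nil, or_false] at hB
  rcases hB with rfl | rfl
  · refine ⟨LinearEquiv.ofBijective s ⟨hK _ (by simp) s fun h0 => ?_, hs⟩⟩
    obtain ⟨x, hx⟩ := exists_ne (0 : B.carrier)
    obtain ⟨k, rfl⟩ := hs x
    exact hx (LinearMap.congr_fun h0 k)
  · exfalso
    have h1 := (bijective_of_surjective_of_injective s (LinearMap.ker q).subtype hs
      (LinearMap.ker q).injective_subtype).2.2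
    obtain ⟨x, hx⟩ := exists_ne (0 : F'.carrier)
    obtain ⟨x, rfl⟩ := hq x
    obtain ⟨k, rfl⟩ := h1 x
    exact hx k.2

end Pentagon

section Moves

variable {Λ : Type} [Ring Λ] [IsArtinianRing Λ]

/-- If the entries of `S` are built from `Y` and an entry `F` of `S`, then replacing `Y, S` by
`F, Y` preserves maximality. -/
theorem IsMaxBHOList.replace (hN : IsNakayama Λ) {L S M P R : List (FDModule Λ)}
    {X Y F : FDModule Λ}
    (hG : IsMaxBHOList (L ++ Y :: (S ++ M))) (hG' : IsMaxBHOList (P ++ X :: R))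
    (hPL : P ⊆ L) (hR : R ⊆ L ++ Y :: (S ++ M)) (hX : X ∈ S ++ M)
    (hYX : HomZero Λ Y.carrier X.carrier) (hS : ∀ B ∈ S, ¬ HomZero Λ B.carrier X.carrier)
    (hF : F ∈ S) (hYF : HomZero Λ Y.carrier F.carrier)
    (hpre : ∀ D : FDModule Λ, HomZero Λ F.carrier D.carrier → HomZero Λ Y.carrier D.carrier →
      ∀ Z ∈ S, HomZero Λ Z.carrier D.carrier)
    (hpost : ∀ D : FDModule Λ, HomZero Λ D.carrier F.carrier → HomZero Λ D.carrier Y.carrier →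
      ∀ Z ∈ S, HomZero Λ D.carrier Z.carrier) :
    IsMaxBHOList (L ++ F :: Y :: M) := by
  refine isMaxBHOList_iff.2 ⟨fun Z hZ => hG.1 Z ?_, ?_, fun D hD l₁ l₂ hl h1 h2 => ?_⟩
  · simp only [List.mem_append, List.mem_cons] at hZ ⊢
    rcases hZ with hZ | rfl | rfl | hZ <;> simp [*]
  · have h0 := hG.2.1
    simp only [listBHO_append_iff, listBHO_cons_iff, List.mem_append, List.mem_cons] at h0 ⊢
    grind
  · have : Nontrivial D.carrier := hD.1
    rcases List.append_eq_append_iff.1 hl with ⟨c, rfl, hc⟩ | ⟨c, rfl, rfl⟩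
    · rcases c with _ | ⟨A, _ | ⟨A', c⟩⟩
      · obtain rfl : l₂ = F :: Y :: M := by simpa using hc.symm
        refine not_subsingleton D.carrier (hG.subsingleton (l₁ := L) (by simpa using h1) ?_)
        simp only [List.mem_cons, forall_eq_or_imp, List.mem_append] at h2 ⊢
        exact ⟨h2.2.1, fun Z hZ => hZ.elim (hpre D h2.1 h2.2.1 Z) (h2.2.2 Z)⟩
      · simp only [List.cons_append, List.nil_append, List.cons.injEq] at hc
        obtain ⟨rfl, rfl⟩ := hc
        exact hG.false_of_middle_cut hG' hPL hR hX hYX hS (hD.uniserial hN)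
          (fun Z hZ => h1 Z (by simp [hZ])) (hpost D (h1 F (by simp))) (h2 Y (by simp))
          fun Z hZ => h2 Z (by simp [hZ])
      · simp only [List.cons_append, List.cons.injEq] at hc
        obtain ⟨rfl, rfl, rfl⟩ := hc
        refine not_subsingleton D.carrier
          (IsMaxBHOList.subsingleton (l₁ := L ++ Y :: (S ++ c)) (l₂ := l₂) (by simpa using hG)
            (fun Z hZ => ?_) h2)
        have h3 := hpost D (h1 F (by simp)) (h1 Y (by simp))
        simp only [List.mem_append, List.mem_cons] at hZ h1
        rcases hZ with hZ | rfl | hZ | hZ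
        · exact h1 Z (Or.inl hZ)
        · exact h1 Z (by simp)
        · exact h3 Z hZ
        · exact h1 Z (by simp [hZ])
    · refine not_subsingleton D.carrier
        (IsMaxBHOList.subsingleton (l₁ := l₁) (l₂ := c ++ Y :: (S ++ M)) (by simpa using hG) h1
          fun Z hZ => ?_)
      have h3 := hpre D (h2 F (by simp)) (h2 Y (by simp))
      simp only [List.mem_append, List.mem_cons] at hZ
      rcases hZ with hZ | rfl | hZ | hZ
      · exact h2 Z (by simp [hZ])
      · exact h2 Z (by simp)
      · exact h3 Z hZ
      · exact h2 Z (by simp [hZ])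

/-- `l'` arises from `l` by swapping two adjacent entries or by an increasing elementary polygonal
deformation. -/
def ListMove (l l' : List (FDModule Λ)) : Prop :=
  (∃ (l₁ l₂ : List (FDModule Λ)) (X Y : FDModule Λ),
    l = l₁ ++ X :: Y :: l₂ ∧ l' = l₁ ++ Y :: X :: l₂) ∨
  ∃ (l₁ l₂ D : List (FDModule Λ)) (X Y : FDModule Λ), D ≠ [] ∧
    l = l₁ ++ X :: (D ++ Y :: l₂) ∧ l' = l₁ ++ Y :: X :: l₂

/-- `l'` arises from `l` by moves through maximal lists. -/
def ListReach (l l' : List (FDModule Λ)) : Prop :=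
  Relation.ReflTransGen (fun l l' => ListMove l l' ∧ IsMaxBHOList l') l l'

omit [IsArtinianRing Λ] in
theorem ListReach.isMaxBHOList {l l' : List (FDModule Λ)} (h : ListReach l l')
    (hl : IsMaxBHOList l) : IsMaxBHOList l' := by
  rcases Relation.ReflTransGen.cases_tail h with rfl | ⟨_, -, -, h⟩
  · exact hl
  · exact h

/-- The increasing adjacent swap of `Y` with a brick mapping to `X`. -/
theorem IsMaxBHOList.swap (hN : IsNakayama Λ) {L M P R : List (FDModule Λ)}
    {X Y F : FDModule Λ}
    (hG : IsMaxBHOList (L ++ Y :: F :: M)) (hG' : IsMaxBHOList (P ++ X :: R))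
    (hPL : P ⊆ L) (hR : R ⊆ L ++ Y :: F :: M) (hX : X ∈ F :: M)
    (hYX : HomZero Λ Y.carrier X.carrier) (hFX : ¬ HomZero Λ F.carrier X.carrier)
    (hYF : HomZero Λ Y.carrier F.carrier) :
    IsMaxBHOList (L ++ F :: Y :: M) :=
  IsMaxBHOList.replace hN (S := [F]) hG hG' hPL hR hX hYX (by simpa using hFX) (by simp) hYF
    (fun D h _ => by simpa using h) (fun D h _ => by simpa using h)

/-- The pentagonal deformation of `Y, F, F'` into `F', Y` when `F` and `F'` map to `X`. -/
theorem IsMaxBHOList.pentagon (hN : IsNakayama Λ) {L M P R : List (FDModule Λ)}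
    {X Y F F' : FDModule Λ}
    (hG : IsMaxBHOList (L ++ Y :: F :: F' :: M)) (hG' : IsMaxBHOList (P ++ X :: R))
    (hPL : P ⊆ L) (hR : R ⊆ L ++ Y :: F :: F' :: M) (hX : X ∈ F :: F' :: M)
    (hYX : HomZero Λ Y.carrier X.carrier) (hFX : ¬ HomZero Λ F.carrier X.carrier)
    (hFX' : ¬ HomZero Λ F'.carrier X.carrier) (hYF : ¬ HomZero Λ Y.carrier F.carrier) :
    IsMaxBHOList (L ++ F' :: Y :: M) := by
  have hF1 : IsMaxBHOList ((L ++ [Y]) ++ F :: F' :: M) := by simpa using hG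
  have hF2 : IsMaxBHOList ((L ++ [Y, F]) ++ F' :: M) := by simpa using hG
  have : Nontrivial X.carrier := hG'.isBrick.1
  have hF'F : HomZero Λ F'.carrier F.carrier := hF1.homZero_tail (by simp)
  obtain ⟨f, hf⟩ := exists_ne_zero_of_not_homZero hFX
  obtain ⟨f', hf'⟩ := exists_ne_zero_of_not_homZero hFX'
  replace hf := hG'.surjective (fun Z hZ => hF1.homZero (by simp [hPL hZ]) (by simp)) f hf
  replace hf' := hG'.surjective (fun Z hZ => hF2.homZero (by simp [hPL hZ]) (by simp)) f' hf'
  rcases hN.surjective_or_surjective (hF1.isBrick.uniserial hN) (hF2.isBrick.uniserial hN)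
    f f' hf hf' with ⟨q, hq⟩ | ⟨q, hq⟩
  · obtain ⟨hYF', ⟨e⟩⟩ := hG.ker_equiv hN hYF q hq hYX hFX hFX'
    refine IsMaxBHOList.replace hN (S := [F, F']) hG hG' hPL hR hX hYX (by simp [hFX, hFX'])
      (by simp) hYF' (fun D h h' => ?_) (fun D h h' => ?_)
    · simpa [h] using HomZero.of_ext_left q hq
        (h'.of_surjective e.symm.toLinearMap e.symm.surjective) h
    · simpa [h] using HomZero.of_ext_right q (h'.of_injective e.toLinearMap e.injective) h
  · have : Nontrivial F.carrier := hF1.isBrick.1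
    exact absurd hF'F (not_homZero_of_surjective q hq)

omit [IsArtinianRing Λ] in
/-- An entry `F` before `X` in one list with a non-zero map to `X` is not an entry of the other
list. -/
theorem IsMaxBHOList.not_mem_of_not_homZero {L M P R : List (FDModule Λ)} {X F : FDModule Λ}
    (hG : IsMaxBHOList (L ++ F :: M)) (hG' : IsMaxBHOList (P ++ X :: R))
    (hPL : P ⊆ L) (hX : X ∈ M) (hFX : ¬ HomZero Λ F.carrier X.carrier) :
    F ∉ P ++ X :: R := fun h => by
  have : Nontrivial F.carrier := hG.isBrick.1
  simp only [List.mem_append, List.mem_cons] at h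
  rcases h with h | rfl | h
  · exact not_homZero_self (hG.homZero (hPL h) List.mem_cons_self)
  · exact not_homZero_self (hG.homZero_tail hX)
  · exact hFX (hG'.homZero_tail h)

/-- An entry `Y` orthogonal to `X` can be moved behind `X` past bricks mapping to `X`. -/
theorem IsMaxBHOList.exists_reach_move (hN : IsNakayama Λ) {P R R' : List (FDModule Λ)}
    {X Y : FDModule Λ} (hG' : IsMaxBHOList (P ++ X :: R'))
    (hYX : HomZero Λ Y.carrier X.carrier) :
    ∀ S L : List (FDModule Λ), IsMaxBHOList (L ++ Y :: (S ++ X :: R)) → P ⊆ L →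
      (∀ B ∈ S, ¬ HomZero Λ B.carrier X.carrier) → P ++ X :: R' ⊆ L ++ Y :: (S ++ X :: R) →
      ∃ S', (∀ B ∈ S', ¬ HomZero Λ B.carrier X.carrier) ∧
        ListReach (L ++ Y :: (S ++ X :: R)) (L ++ (S' ++ X :: Y :: R)) ∧
        P ++ X :: R' ⊆ L ++ (S' ++ X :: Y :: R)
  | [], L, hG, hPL, _, hsub => by
    have : Nontrivial X.carrier := hG'.isBrick.1
    have hmax := hG.swap hN hG' hPL (fun Z hZ => hsub (by simp [hZ])) (by simp) hYX
      not_homZero_self hYX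
    refine ⟨[], by simp, .single ⟨Or.inl ⟨L, R, Y, X, rfl, rfl⟩, hmax⟩, fun Z hZ => ?_⟩
    have := hsub hZ
    simp only [List.mem_append, List.mem_cons, List.nil_append] at this ⊢
    tauto
  | F :: S, L, hG, hPL, hS, hsub => by
    have : Nontrivial X.carrier := hG'.isBrick.1
    have hR : R' ⊆ L ++ Y :: F :: (S ++ X :: R) := fun Z hZ => hsub (by simp [hZ])
    have hFX := hS F (by simp)
    by_cases hYF : HomZero Λ Y.carrier F.carrier
    · have hmax := IsMaxBHOList.swap hN hG hG' hPL hR (by simp) hYX hFX hYF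
      obtain ⟨S', h1, h2, h3⟩ := IsMaxBHOList.exists_reach_move hN hG' hYX S (L ++ [F])
        (by simpa using hmax) (fun Z hZ => by simp [hPL hZ]) (fun B hB => hS B (by simp [hB]))
        (fun Z hZ => by
          have := hsub hZ
          simp only [List.mem_append, List.mem_cons, List.cons_append, List.not_mem_nil] at this ⊢
          tauto)
      refine ⟨F :: S', by simpa [hFX] using h1, .head ⟨Or.inl ⟨L, _, Y, F, rfl, rfl⟩, hmax⟩ ?_,
        by simpa using h3⟩
      simpa [ListReach] using h2
    · have hFm : F ∉ P ++ X :: R' := IsMaxBHOList.not_mem_of_not_homZero (L := L ++ [Y])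
        (M := S ++ X :: R) (by simpa using hG) hG' (fun Z hZ => by simp [hPL hZ]) (by simp) hFX
      match S, hS with
      | [], hS =>
        have hmax := IsMaxBHOList.pentagon hN hG hG' hPL hR (by simp) hYX hFX
          not_homZero_self hYF
        refine ⟨[], by simp, .single ⟨Or.inr ⟨L, R, [F], Y, X, by simp, rfl, rfl⟩, hmax⟩,
          fun Z hZ => ?_⟩
        have h1 := hsub hZ
        have h2 : Z ≠ F := fun h => hFm (h ▸ hZ)
        simp only [List.mem_append, List.mem_cons, List.nil_append, List.cons_append] at h1 ⊢
        tauto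
      | F' :: S, hS =>
        have hFX' := hS F' (by simp)
        have hmax := IsMaxBHOList.pentagon hN hG hG' hPL hR (by simp) hYX hFX hFX' hYF
        obtain ⟨S', h1, h2, h3⟩ := IsMaxBHOList.exists_reach_move hN hG' hYX S (L ++ [F'])
          (by simpa using hmax) (fun Z hZ => by simp [hPL hZ]) (fun B hB => hS B (by simp [hB]))
          (fun Z hZ => by
            have h1 := hsub hZ
            have h2 : Z ≠ F := fun h => hFm (h ▸ hZ)
            simp only [List.mem_append, List.mem_cons, List.cons_append, List.not_mem_nil]
              at h1 ⊢
            tauto)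
        refine ⟨F' :: S', by simpa [hFX'] using h1,
          .head ⟨Or.inr ⟨L, _, [F], Y, F', by simp, rfl, rfl⟩, hmax⟩ ?_, by simpa using h3⟩
        simpa [ListReach] using h2
termination_by S => S.length

/-- The first entry `X` of `G'` after the common part `P` can be moved directly behind `P`. -/
theorem IsMaxBHOList.exists_reach_cons (hN : IsNakayama Λ) {P R' : List (FDModule Λ)}
    {X : FDModule Λ} (hG' : IsMaxBHOList (P ++ X :: R')) (Q : List (FDModule Λ)) :
    ∀ S R : List (FDModule Λ), IsMaxBHOList (P ++ (Q ++ (S ++ X :: R))) →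
      (∀ B ∈ S, ¬ HomZero Λ B.carrier X.carrier) →
      P ++ X :: R' ⊆ P ++ (Q ++ (S ++ X :: R)) →
      ∃ R₂, ListReach (P ++ (Q ++ (S ++ X :: R))) (P ++ X :: R₂) ∧
        P ++ X :: R' ⊆ P ++ X :: R₂ := by
  induction Q using List.reverseRecOn with
  | nil =>
    intro S R hG hS hsub
    match S, hS with
    | [], _ => exact ⟨R, .refl, hsub⟩
    | F :: S, hS =>
      exfalso
      have hG1 : IsMaxBHOList (P ++ F :: (S ++ X :: R)) := hG
      have : Nontrivial F.carrier := hG1.isBrick.1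
      have hFP : ∀ Z ∈ P, HomZero Λ F.carrier Z.carrier := fun Z hZ =>
        hG1.homZero hZ List.mem_cons_self
      have hFm := hG1.not_mem_of_not_homZero hG' (fun _ h => h) (by simp) (hS F (by simp))
      refine hG'.not_homZero_right hFP (fun Z hZ => hG1.homZero_tail ?_)
        (hG1.homZero_tail (by simp))
      have h1 : Z ∈ P ++ F :: (S ++ X :: R) := hsub (by simp [hZ])
      simp only [List.mem_append, List.mem_cons] at h1 ⊢
      rcases h1 with h1 | rfl | h1
      · have : Nontrivial Z.carrier := (hG'.1 Z (by simp [hZ])).1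
        exact absurd (hG'.homZero h1 (by simp [hZ])) not_homZero_self
      · exact absurd (by simp [hZ]) hFm
      · exact h1
  | append_singleton Q Y ih =>
    intro S R hG hS hsub
    by_cases hYX : HomZero Λ Y.carrier X.carrier
    · obtain ⟨S', h1, h2, h3⟩ := IsMaxBHOList.exists_reach_move hN hG' hYX S (P ++ Q)
        (by simpa using hG) (fun Z hZ => by simp [hZ]) hS (by simpa using hsub)
      obtain ⟨R₂, h4, h5⟩ := ih S' (Y :: R)
        (by simpa using h2.isMaxBHOList (by simpa using hG)) h1 (by simpa using h3)
      exact ⟨R₂, Relation.ReflTransGen.trans (by simpa [ListReach] using h2) h4, h5⟩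
    · obtain ⟨R₂, h4, h5⟩ := ih (Y :: S) R (by simpa using hG) (by simpa [hYX] using hS)
        (by simpa using hsub)
      exact ⟨R₂, by simpa using h4, h5⟩

/-- A maximal list reaches every maximal list made of its entries and sharing an initial part. -/
theorem IsMaxBHOList.reach (hN : IsNakayama Λ) :
    ∀ R' P R : List (FDModule Λ), IsMaxBHOList (P ++ R) → IsMaxBHOList (P ++ R') →
      P ++ R' ⊆ P ++ R → ListReach (P ++ R) (P ++ R')
  | [], P, R, hG, hG', hsub => by
    match R with
    | [] => exact .refl
    | F :: R =>
      have : Nontrivial F.carrier := hG.isBrick.1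
      exact absurd (hG'.subsingleton (fun Z hZ => hG.homZero hZ List.mem_cons_self) (by simp))
        (not_subsingleton F.carrier)
  | X :: R', P, R, hG, hG', hsub => by
    have hX : X ∈ R := by
      refine (List.mem_append.1 (hsub (a := X) (by simp))).resolve_left fun h => ?_
      have : Nontrivial X.carrier := hG'.isBrick.1
      exact not_homZero_self (hG'.homZero h List.mem_cons_self)
    obtain ⟨Q, R, rfl⟩ := List.append_of_mem hX
    obtain ⟨R₂, h1, h2⟩ := hG'.exists_reach_cons hN Q [] R hG (by simp) hsub
    have h3 := IsMaxBHOList.reach hN R' (P ++ [X]) R₂ (by simpa using h1.isMaxBHOList hG)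
      (by simpa using hG') (by simpa using h2)
    exact h1.trans (by simpa [ListReach] using h3)

end Moves

section Transfer

variable {Λ : Type} [Ring Λ]

theorem exists_forall₂_iso {G G' : List (FDModule Λ)}
    (h : ∀ N ∈ G', ∃ M ∈ G, Nonempty (N.carrier ≃ₗ[Λ] M.carrier)) :
    ∃ G'', List.Forall₂ (fun M N => Nonempty (M.carrier ≃ₗ[Λ] N.carrier)) G'' G' ∧ G'' ⊆ G := by
  induction G' with
  | nil => exact ⟨[], .nil, by simp⟩
  | cons N G' ih =>
    obtain ⟨G'', h1, h2⟩ := ih fun N' hN' => h N' (by simp [hN'])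
    obtain ⟨M, hM, ⟨e⟩⟩ := h N (by simp)
    exact ⟨M :: G'', .cons ⟨e.symm⟩ h1, List.cons_subset.2 ⟨hM, h2⟩⟩

theorem exists_iso_of_mem_right {l l' : List (FDModule Λ)}
    (h : List.Forall₂ (fun M N => Nonempty (M.carrier ≃ₗ[Λ] N.carrier)) l l') {N : FDModule Λ}
    (hN : N ∈ l') : ∃ M ∈ l, Nonempty (M.carrier ≃ₗ[Λ] N.carrier) := by
  induction h with
  | nil => simp at hN
  | @cons M N' l l' he _ ih =>
    rcases List.mem_cons.1 hN with rfl | hN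
    · exact ⟨M, by simp, he⟩
    · obtain ⟨M', hM', he'⟩ := ih hN
      exact ⟨M', by simp [hM'], he'⟩

theorem exists_iso_of_mem_left {l l' : List (FDModule Λ)}
    (h : List.Forall₂ (fun M N => Nonempty (M.carrier ≃ₗ[Λ] N.carrier)) l l') {M : FDModule Λ}
    (hM : M ∈ l) : ∃ N ∈ l', Nonempty (M.carrier ≃ₗ[Λ] N.carrier) := by
  obtain ⟨N, hN, ⟨e⟩⟩ := exists_iso_of_mem_right
    (List.Forall₂.flip (h.imp fun _ _ ⟨e⟩ => (⟨e.symm⟩ : Nonempty _))) hM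
  exact ⟨N, hN, ⟨e.symm⟩⟩

theorem ListBHO.of_forall₂_iso {l l' : List (FDModule Λ)} (h' : ListBHO l')
    (h : List.Forall₂ (fun M N => Nonempty (M.carrier ≃ₗ[Λ] N.carrier)) l l') : ListBHO l := by
  induction h with
  | nil => exact List.Pairwise.nil
  | @cons M N l l' he hl ih =>
    rw [listBHO_cons_iff] at h' ⊢
    refine ⟨fun B hB => ?_, ih h'.2⟩
    obtain ⟨e⟩ := he
    obtain ⟨C, hC, ⟨e'⟩⟩ := exists_iso_of_mem_left hl hB
    exact ((h'.1 C hC).of_surjective e'.symm.toLinearMap e'.symm.surjective).of_injective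
      e.toLinearMap e.injective

theorem IsMaxBHOList.of_forall₂_iso {l l' : List (FDModule Λ)} (h' : IsMaxBHOList l')
    (h : List.Forall₂ (fun M N => Nonempty (M.carrier ≃ₗ[Λ] N.carrier)) l l')
    (hb : ∀ M ∈ l, IsBrick M) : IsMaxBHOList l := by
  rw [isMaxBHOList_iff] at h' ⊢
  refine ⟨hb, h'.2.1.of_forall₂_iso h, fun C hC l₁ l₂ hl h1 h2 => ?_⟩
  subst hl
  have ht := List.forall₂_take l₁.length h
  have hd := List.forall₂_drop l₁.length h
  rw [List.take_left] at ht
  rw [List.drop_left] at hd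
  refine h'.2.2 C hC _ _ (List.take_append_drop l₁.length l').symm (fun Z hZ => ?_) fun Z hZ => ?_
  · obtain ⟨M, hM, ⟨e⟩⟩ := exists_iso_of_mem_right ht hZ
    exact (h1 M hM).of_injective e.symm.toLinearMap e.symm.injective
  · obtain ⟨M, hM, ⟨e⟩⟩ := exists_iso_of_mem_right hd hZ
    exact (h2 M hM).of_surjective e.toLinearMap e.surjective

theorem ListReach.exists_seq {l l' : List (FDModule Λ)} (h : ListReach l l')
    (hl : IsMaxBHOList l) :
    ∃ (n : ℕ) (seq : Fin (n + 1) → List (FDModule Λ)), seq 0 = l ∧ seq (Fin.last n) = l' ∧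
      (∀ m, IsMaxBHOList (seq m)) ∧ ∀ m : Fin n, ListMove (seq m.castSucc) (seq m.succ) := by
  induction h using Relation.ReflTransGen.head_induction_on with
  | refl => exact ⟨0, fun _ => l', rfl, rfl, fun _ => hl, fun m => m.elim0⟩
  | @head l l₁ h1 _ ih =>
    obtain ⟨n, seq, h0, hn, hmax, hmove⟩ := ih h1.2
    refine ⟨n + 1, Fin.cons l seq, rfl, ?_, ?_, ?_⟩
    · rw [← Fin.succ_last, Fin.cons_succ, hn]
    · exact Fin.cases hl hmax
    · refine Fin.cases ?_ fun m => ?_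
      · rw [Fin.castSucc_zero, Fin.cons_zero, Fin.cons_succ, h0]
        exact h1.1
      · rw [← Fin.succ_castSucc, Fin.cons_succ, Fin.cons_succ]
        exact hmove m

end Transfer

/-- over a Nakayama algebra, if every entry of the maximal backwards
Hom-orthogonal sequence of bricks `G'` is isomorphic to an entry of `G`, then `G`
can be transformed into `G'` (up to isomorphism of corresponding entries) by a
finite sequence of adjacent swaps and increasing elementary polygonal
deformations, all intermediate sequences being maximal backwards Hom-orthogonal
sequences of bricks. -/
theorem statement_14 (K : Type) [Field K] (Λ : Type) [Ring Λ] [Algebra K Λ]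
    [FiniteDimensional K Λ] (hNak : IsNakayama Λ)
    (G G' : List (FDModule Λ)) (hG : IsMaxBHOList G) (hG' : IsMaxBHOList G')
    (h2 : ∀ N ∈ G', ∃ M ∈ G, Nonempty (N.carrier ≃ₗ[Λ] M.carrier)) :
    ∃ (n : ℕ) (seq : Fin (n + 1) → List (FDModule Λ)),
      seq 0 = G ∧ (∀ m, IsMaxBHOList (seq m)) ∧
      (∀ m : Fin n,
        (∃ (l₁ l₂ : List (FDModule Λ)) (X Y : FDModule Λ),
          seq m.castSucc = l₁ ++ X :: Y :: l₂ ∧ seq m.succ = l₁ ++ Y :: X :: l₂) ∨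
        (∃ (l₁ l₂ D : List (FDModule Λ)) (X Y : FDModule Λ), D ≠ [] ∧
          seq m.castSucc = l₁ ++ X :: (D ++ Y :: l₂) ∧
          seq m.succ = l₁ ++ Y :: X :: l₂)) ∧
      List.Forall₂ (fun M N => Nonempty (M.carrier ≃ₗ[Λ] N.carrier))
        (seq (Fin.last n)) G' := by
  have : IsArtinianRing Λ := isArtinian_of_tower K inferInstance
  obtain ⟨G'', hiso, hsub⟩ := exists_forall₂_iso h2
  have hG'' := hG'.of_forall₂_iso hiso fun M hM => hG.1 M (hsub hM)
  obtain ⟨n, seq, h0, hl, hmax, hmove⟩ :=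
    ListReach.exists_seq (IsMaxBHOList.reach hNak G'' [] G hG hG'' hsub) hG
  exact ⟨n, seq, h0, hmax, hmove, hl ▸ hiso⟩
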